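/- Let δ ∈ ℝ and 1 ≤ p < ∞. If δ > p − 1, then the logarithmic dual Hardy operator H_∞^{−1,log} is bounded on L^p(ℝ₊, x^δ dx). If δ ≤ p − 1, then H_∞^{−1,log} is not of restricted weak type (p,p) with respect to (ℝ₊, x^δ dx). -/

import Mathlib

open MeasureTheory Set ENNReal
open scoped NNReal

noncomputable section

/-- The measure `x^δ dx` on `(0,∞)`. -/
def powMeasure (δ : ℝ) : Measure ℝ :=
  (volume.restrict (Ioi (0:ℝ))).withDensity (fun x => ENNReal.ofReal (x ^ δ))

/-- `f ∈ L^p(ℝ₊, x^δ dx)` for a real exponent `p`. -/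
def MemLpPow (f : ℝ → ℝ) (p δ : ℝ) : Prop :=
  AEMeasurable f (powMeasure δ) ∧
    ∫⁻ x, ENNReal.ofReal |f x| ^ p ∂(powMeasure δ) < ⊤

/-- `T` is of strong type `(p,p)` with respect to `(ℝ₊, x^δ dx)`. -/
def IsStrongType (T : (ℝ → ℝ) → (ℝ → ℝ)) (p δ : ℝ) : Prop :=
  ∃ C : ℝ≥0, ∀ f : ℝ → ℝ, MemLpPow f p δ →
    ∫⁻ x, ENNReal.ofReal |T f x| ^ p ∂(powMeasure δ) ≤
      C * ∫⁻ x, ENNReal.ofReal |f x| ^ p ∂(powMeasure δ)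

/-- `T` is of strong type `(∞,∞)`, i.e. bounded on `L^∞(ℝ₊, dx)`. -/
def IsStrongTypeInfty (T : (ℝ → ℝ) → (ℝ → ℝ)) : Prop :=
  ∃ C : ℝ≥0, ∀ f : ℝ → ℝ,
    eLpNorm (T f) ⊤ (volume.restrict (Ioi (0:ℝ))) ≤
      C * eLpNorm f ⊤ (volume.restrict (Ioi (0:ℝ)))

/-- `T` is of weak type `(p,p)` with respect to `(ℝ₊, x^δ dx)`. -/
def IsWeakType (T : (ℝ → ℝ) → (ℝ → ℝ)) (p δ : ℝ) : Prop :=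
  ∃ C : ℝ≥0, ∀ f : ℝ → ℝ, MemLpPow f p δ → ∀ l : ℝ, 0 < l →
    ENNReal.ofReal (l ^ p) * powMeasure δ {y | l < |T f y|} ≤
      C * ∫⁻ x, ENNReal.ofReal |f x| ^ p ∂(powMeasure δ)

/-- `T` is of restricted weak type `(p,p)` with respect to `(ℝ₊, x^δ dx)`:
the weak type inequality holds uniformly over indicator functions of sets of
finite `x^δ dx` measure. -/
def IsRestrictedWeakType (T : (ℝ → ℝ) → (ℝ → ℝ)) (p δ : ℝ) : Prop :=
  ∃ C : ℝ≥0, ∀ E : Set ℝ, MeasurableSet E → powMeasure δ E < ⊤ → ∀ l : ℝ, 0 < l →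
    ENNReal.ofReal (l ^ p) * powMeasure δ {y | l < |T (E.indicator 1) y|} ≤
      C * powMeasure δ E

/-- The logarithmic dual Hardy operator `H_∞^{-1,log}`. -/
def Hinflog (f : ℝ → ℝ) (x : ℝ) : ℝ :=
  x⁻¹ * ∫ y in Ioi x, Real.log (y / x) * f y

/-- Jensen's inequality for powers with respect to an unnormalised measure. -/
theorem lintegral_rpow_le_measure_univ_rpow_mul {α : Type*} [MeasurableSpace α] (μ : Measure α)
    {g : α → ℝ≥0∞} (hg : AEMeasurable g μ) {p : ℝ} (hp : 1 ≤ p) :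
    (∫⁻ a, g a ∂μ) ^ p ≤ μ univ ^ (p - 1) * ∫⁻ a, g a ^ p ∂μ := by
  have hp0 : 0 < p := by linarith
  have h := eLpNorm'_le_eLpNorm'_mul_rpow_measure_univ (μ := μ) (f := g) one_pos hp
    hg.aestronglyMeasurable
  simp only [eLpNorm'_eq_lintegral_enorm, enorm_eq_self, rpow_one, div_one] at h
  calc (∫⁻ a, g a ∂μ) ^ p
      ≤ ((∫⁻ a, g a ^ p ∂μ) ^ (1 / p) * μ univ ^ (1 - 1 / p)) ^ p := by gcongr
    _ = μ univ ^ (p - 1) * ∫⁻ a, g a ^ p ∂μ := by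
      rw [ENNReal.mul_rpow_of_nonneg _ _ hp0.le, ← ENNReal.rpow_mul, ← ENNReal.rpow_mul,
        one_div_mul_cancel hp0.ne', rpow_one, mul_comm]
      congr 2
      field_simp

theorem lintegral_Ioi_rpow_mul_rpow_le {x ε p : ℝ} (hx : 0 < x) (hε : 0 < ε) (hp : 1 ≤ p)
    {g : ℝ → ℝ≥0∞} (hg : Measurable g) :
    (∫⁻ y in Ioi x, ENNReal.ofReal (y ^ ε) * g y) ^ p ≤
      ENNReal.ofReal (x ^ (-ε) / ε) ^ (p - 1) *
        ∫⁻ y in Ioi x, ENNReal.ofReal (y ^ ((1 + 2 * ε) * p - 1 - ε)) * g y ^ p := by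
  have hw : Measurable fun y : ℝ => ENNReal.ofReal (y ^ (-1 - ε)) := by fun_prop
  have hh : Measurable fun y : ℝ => ENNReal.ofReal (y ^ (1 + 2 * ε)) * g y := by fun_prop
  have key := lintegral_rpow_le_measure_univ_rpow_mul
    ((volume.restrict (Ioi x)).withDensity fun y : ℝ => ENNReal.ofReal (y ^ (-1 - ε)))
    hh.aemeasurable hp
  rw [lintegral_withDensity_eq_lintegral_mul _ hw hh,
    lintegral_withDensity_eq_lintegral_mul _ hw (hh.pow_const p),
    withDensity_apply _ MeasurableSet.univ, Measure.restrict_univ,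
    ← ofReal_integral_eq_lintegral_ofReal (integrableOn_Ioi_rpow_of_lt (by linarith) hx)
      ((ae_restrict_mem measurableSet_Ioi).mono fun y hy =>
        Real.rpow_nonneg (hx.trans hy).le _),
    integral_Ioi_rpow_of_lt (by linarith) hx] at key
  convert key using 1
  · congr 1
    refine setLIntegral_congr_fun measurableSet_Ioi fun y hy => ?_
    have hy0 : 0 < y := hx.trans hy
    simp only [Pi.mul_apply]
    rw [← mul_assoc, ← ENNReal.ofReal_mul (by positivity), ← Real.rpow_add hy0]
    ring_nf
  · congr 1
    · congr 2
      rw [show -1 - ε + 1 = -ε by ring, neg_div_neg_eq]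
    · refine setLIntegral_congr_fun measurableSet_Ioi fun y hy => ?_
      have hy0 : 0 < y := hx.trans hy
      simp only [Pi.mul_apply]
      rw [ENNReal.mul_rpow_of_nonneg _ _ (by linarith),
        ENNReal.ofReal_rpow_of_nonneg (by positivity) (by linarith), ← mul_assoc,
        ← ENNReal.ofReal_mul (by positivity), ← Real.rpow_mul hy0.le, ← Real.rpow_add hy0]
      ring_nf

theorem lintegral_Ioi_rpow_mul_lintegral_Ioi {b : ℝ} (hb : -1 < b) {h : ℝ → ℝ≥0∞}
    (hh : Measurable h) :
    ∫⁻ x in Ioi (0 : ℝ), ENNReal.ofReal (x ^ b) * ∫⁻ y in Ioi x, h y =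
      ∫⁻ y in Ioi (0 : ℝ), ENNReal.ofReal (y ^ (b + 1) / (b + 1)) * h y := by
  have hF : Measurable (Function.uncurry fun x y : ℝ =>
      {q : ℝ × ℝ | q.1 < q.2}.indicator
        (fun q : ℝ × ℝ => ENNReal.ofReal (q.1 ^ b) * h q.2) (x, y)) := by
    refine Measurable.indicator ?_ (measurableSet_lt measurable_fst measurable_snd)
    fun_prop
  calc ∫⁻ x in Ioi (0 : ℝ), ENNReal.ofReal (x ^ b) * ∫⁻ y in Ioi x, h y
      = ∫⁻ x in Ioi (0 : ℝ), ∫⁻ y in Ioi (0 : ℝ), {q : ℝ × ℝ | q.1 < q.2}.indicator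
          (fun q : ℝ × ℝ => ENNReal.ofReal (q.1 ^ b) * h q.2) (x, y) := by
        refine setLIntegral_congr_fun measurableSet_Ioi fun x hx => ?_
        rw [← lintegral_const_mul _ hh, ← inter_eq_self_of_subset_left (Ioi_subset_Ioi hx.le),
          ← setLIntegral_indicator measurableSet_Ioi]
        rfl
    _ = ∫⁻ y in Ioi (0 : ℝ), ∫⁻ x in Ioi (0 : ℝ), {q : ℝ × ℝ | q.1 < q.2}.indicator
          (fun q : ℝ × ℝ => ENNReal.ofReal (q.1 ^ b) * h q.2) (x, y) :=
        lintegral_lintegral_swap hF.aemeasurable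
    _ = _ := by
        refine setLIntegral_congr_fun measurableSet_Ioi fun y hy => ?_
        have hy0 : (0 : ℝ) < y := hy
        have h1 : ∫⁻ x in Ioc 0 y, ENNReal.ofReal (x ^ b) =
            ENNReal.ofReal (y ^ (b + 1) / (b + 1)) := by
          rw [← ofReal_integral_eq_lintegral_ofReal
            ((intervalIntegrable_iff_integrableOn_Ioc_of_le hy0.le).1
              (intervalIntegral.intervalIntegrable_rpow' hb))
            ((ae_restrict_mem measurableSet_Ioc).mono fun x hx => Real.rpow_nonneg hx.1.le _),
            ← intervalIntegral.integral_of_le hy0.le, integral_rpow (Or.inl hb),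
            Real.zero_rpow (by linarith), sub_zero]
        rw [← h1, ← lintegral_mul_const _ (by fun_prop), ← restrict_Ioo_eq_restrict_Ioc,
          show Ioo 0 y = Iio y ∩ Ioi 0 by ext; simp [and_comm],
          ← setLIntegral_indicator measurableSet_Iio]
        rfl

theorem volume_restrict_Ioi_absolutelyContinuous_powMeasure (δ : ℝ) :
    volume.restrict (Ioi (0 : ℝ)) ≪ powMeasure δ := by
  refine withDensity_absolutelyContinuous' (by fun_prop) ?_
  filter_upwards [ae_restrict_mem measurableSet_Ioi] with x hx
  exact (ENNReal.ofReal_pos.2 (Real.rpow_pos_of_pos hx _)).ne'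

theorem lintegral_powMeasure (δ : ℝ) {g : ℝ → ℝ≥0∞} (hg : AEMeasurable g (powMeasure δ)) :
    ∫⁻ x, g x ∂(powMeasure δ) = ∫⁻ x in Ioi (0 : ℝ), ENNReal.ofReal (x ^ δ) * g x :=
  lintegral_withDensity_eq_lintegral_mul₀ (by fun_prop)
    (hg.mono_ac (volume_restrict_Ioi_absolutelyContinuous_powMeasure δ))

theorem ofReal_abs_Hinflog_le {x ε : ℝ} (hx : 0 < x) (hε : 0 < ε) (f : ℝ → ℝ) :
    ENNReal.ofReal |Hinflog f x| ≤
      ENNReal.ofReal (ε⁻¹ * x ^ (-1 - ε)) *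
        ∫⁻ y in Ioi x, ENNReal.ofReal (y ^ ε) * ENNReal.ofReal |f y| := by
  have h1 : ENNReal.ofReal |∫ y in Ioi x, Real.log (y / x) * f y| ≤
      ∫⁻ y in Ioi x, ENNReal.ofReal (ε⁻¹ * x ^ (-ε)) *
        (ENNReal.ofReal (y ^ ε) * ENNReal.ofReal |f y|) := by
    rw [← Real.enorm_eq_ofReal_abs]
    refine (enorm_integral_le_lintegral_enorm _).trans
      (setLIntegral_mono' measurableSet_Ioi fun y hy => ?_)
    have hy0 : 0 < y := hx.trans hy
    have hlog : 0 ≤ Real.log (y / x) := Real.log_nonneg ((one_le_div hx).2 hy.le)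
    rw [Real.enorm_eq_ofReal_abs, abs_mul, abs_of_nonneg hlog, ENNReal.ofReal_mul hlog,
      ← mul_assoc, ← ENNReal.ofReal_mul (p := ε⁻¹ * x ^ (-ε)) (by positivity)]
    gcongr
    refine (Real.log_le_rpow_div (by positivity) hε).trans_eq ?_
    rw [Real.div_rpow hy0.le hx.le, Real.rpow_neg hx.le]
    field_simp
  rw [lintegral_const_mul' _ _ ENNReal.ofReal_ne_top] at h1
  rw [Hinflog, abs_mul, ENNReal.ofReal_mul (abs_nonneg _), abs_of_pos (inv_pos.2 hx)]
  refine (mul_le_mul_right h1 _).trans_eq ?_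
  rw [← mul_assoc, ← ENNReal.ofReal_mul (by positivity), sub_eq_add_neg, Real.rpow_add hx,
    Real.rpow_neg_one]
  ring_nf

theorem isStrongType_Hinflog {δ p : ℝ} (hp : 1 ≤ p) (hδ : p - 1 < δ) :
    IsStrongType Hinflog p δ := by
  obtain ⟨ε, hε, hεδ⟩ : ∃ ε : ℝ, 0 < ε ∧ (2 * p - 1) * ε < δ - (p - 1) := by
    refine ⟨(δ - (p - 1)) / (2 * (2 * p - 1)), div_pos (by linarith) (by linarith), ?_⟩
    have : 2 * p - 1 ≠ 0 := by linarith
    field_simp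
    linarith
  have hp0 : 0 < p := by linarith
  set b := δ - (1 + ε) * p - ε * (p - 1) with hb_def
  set c := (1 + 2 * ε) * p - 1 - ε with hc_def
  have hb : -1 < b := by linarith
  set K := ε⁻¹ ^ p * ε⁻¹ ^ (p - 1) with hK
  have hK0 : 0 < K := by positivity
  refine ⟨(K / (b + 1)).toNNReal, fun f hf => ?_⟩
  obtain ⟨hfm, -⟩ := hf
  have hgm : AEMeasurable (fun x => ENNReal.ofReal |f x|) (powMeasure δ) := by fun_prop
  obtain ⟨g, hg, hfg⟩ := hgm
  have hfg0 := (volume_restrict_Ioi_absolutelyContinuous_powMeasure δ).ae_eq hfg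
  rw [lintegral_congr_ae (f := fun x => ENNReal.ofReal |f x| ^ p) (g := fun x => g x ^ p)
    (hfg.fun_comp (· ^ p)), lintegral_powMeasure δ (g := fun x => g x ^ p) (by fun_prop)]
  calc ∫⁻ x, ENNReal.ofReal |Hinflog f x| ^ p ∂(powMeasure δ)
      ≤ ∫⁻ x in Ioi (0 : ℝ), ENNReal.ofReal (x ^ δ) * ENNReal.ofReal |Hinflog f x| ^ p :=
        lintegral_withDensity_le_lintegral_mul _ (by fun_prop) _
    _ ≤ ∫⁻ x in Ioi (0 : ℝ), ENNReal.ofReal K * (ENNReal.ofReal (x ^ b) *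
          ∫⁻ y in Ioi x, ENNReal.ofReal (y ^ c) * g y ^ p) := by
        refine setLIntegral_mono' measurableSet_Ioi fun x hx => ?_
        have hx0 : (0 : ℝ) < x := hx
        have hH := ofReal_abs_Hinflog_le hx0 hε f
        rw [lintegral_congr_ae (g := fun y => ENNReal.ofReal (y ^ ε) * g y) (by
          filter_upwards [ae_restrict_of_ae_restrict_of_subset (Ioi_subset_Ioi hx0.le) hfg0]
            with y hy
          rw [hy])] at hH
        calc ENNReal.ofReal (x ^ δ) * ENNReal.ofReal |Hinflog f x| ^ p
            ≤ ENNReal.ofReal (x ^ δ) * (ENNReal.ofReal (ε⁻¹ * x ^ (-1 - ε)) ^ p *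
                (ENNReal.ofReal (x ^ (-ε) / ε) ^ (p - 1) *
                  ∫⁻ y in Ioi x, ENNReal.ofReal (y ^ c) * g y ^ p)) := by
              grw [hH, ENNReal.mul_rpow_of_nonneg _ _ hp0.le,
                lintegral_Ioi_rpow_mul_rpow_le hx0 hε hp hg]
          _ = _ := by
              rw [ENNReal.ofReal_rpow_of_nonneg (by positivity) hp0.le,
                ENNReal.ofReal_rpow_of_nonneg (by positivity) (by linarith), ← mul_assoc,
                ← mul_assoc, ← mul_assoc, ← ENNReal.ofReal_mul (by positivity),
                ← ENNReal.ofReal_mul (by positivity), ← ENNReal.ofReal_mul hK0.le]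
              congr 2
              rw [div_eq_inv_mul, Real.mul_rpow (by positivity) (by positivity),
                Real.mul_rpow (by positivity) (by positivity), ← Real.rpow_mul hx0.le,
                ← Real.rpow_mul hx0.le, hK,
                show b = δ + (-1 - ε) * p + -ε * (p - 1) by rw [hb_def]; ring,
                Real.rpow_add hx0, Real.rpow_add hx0]
              ring
    _ = ENNReal.ofReal K * ∫⁻ y in Ioi (0 : ℝ),
          ENNReal.ofReal (y ^ (b + 1) / (b + 1)) * (ENNReal.ofReal (y ^ c) * g y ^ p) := by
        rw [lintegral_const_mul' _ _ ENNReal.ofReal_ne_top,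
          lintegral_Ioi_rpow_mul_lintegral_Ioi hb (by fun_prop)]
    _ = _ := by
        rw [← lintegral_const_mul' _ _ ENNReal.ofReal_ne_top,
          ← lintegral_const_mul' _ _ ENNReal.coe_ne_top]
        refine setLIntegral_congr_fun measurableSet_Ioi fun y hy => ?_
        have hy0 : (0 : ℝ) < y := hy
        have hb1 : 0 < b + 1 := by linarith
        change _ = ENNReal.ofReal (K / (b + 1)) * _
        rw [← mul_assoc, ← mul_assoc, ← mul_assoc, ← ENNReal.ofReal_mul hK0.le,
          ← ENNReal.ofReal_mul (by positivity), ← ENNReal.ofReal_mul (by positivity),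
          show δ = (b + 1) + c by rw [hb_def, hc_def]; ring, Real.rpow_add hy0 (b + 1) c]
        congr 2
        ring

theorem powMeasure_Icc_one_two_lt_top (δ : ℝ) : powMeasure δ (Icc 1 2) < ⊤ := by
  rw [powMeasure, withDensity_apply _ measurableSet_Icc]
  refine (setLIntegral_mono' (g := fun _ => ENNReal.ofReal (2 ^ |δ|)) measurableSet_Icc
    fun x hx => ENNReal.ofReal_le_ofReal ?_).trans_lt ?_
  · exact (Real.rpow_le_rpow_of_exponent_le hx.1 (le_abs_self δ)).trans
      (Real.rpow_le_rpow (by linarith [hx.1]) hx.2 (abs_nonneg δ))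
  · rw [setLIntegral_const]
    refine ENNReal.mul_lt_top ENNReal.ofReal_lt_top ?_
    exact (Measure.restrict_apply_le _ _).trans_lt (by simp)

theorem le_powMeasure_Ioo (δ : ℝ) {a : ℝ} (ha : 0 < a) :
    ENNReal.ofReal ((1 / 2) ^ (|δ| + 1) * a ^ (δ + 1)) ≤ powMeasure δ (Ioo 0 a) := by
  have hsub : Ioo (a / 2) a ⊆ Ioo 0 a := Ioo_subset_Ioo_left (by linarith)
  refine le_trans ?_ (measure_mono hsub)
  rw [powMeasure, withDensity_apply _ measurableSet_Ioo,
    Measure.restrict_restrict_of_subset (hsub.trans Ioo_subset_Ioi_self)]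
  calc ENNReal.ofReal ((1 / 2) ^ (|δ| + 1) * a ^ (δ + 1))
      = ∫⁻ _ in Ioo (a / 2) a, ENNReal.ofReal ((1 / 2) ^ |δ| * a ^ δ) := by
        rw [setLIntegral_const, Real.volume_Ioo, ← ENNReal.ofReal_mul (by positivity),
          Real.rpow_add (by norm_num), Real.rpow_add ha, Real.rpow_one, Real.rpow_one]
        ring_nf
    _ ≤ _ := by
        refine setLIntegral_mono' measurableSet_Ioo fun x hx => ENNReal.ofReal_le_ofReal ?_
        have hx0 : 0 < x := by linarith [hx.1]
        have h1 : 1 / 2 ≤ x / a := by rw [le_div_iff₀ ha]; linarith [hx.1]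
        have h2 : x / a ≤ 1 := (div_le_one ha).2 hx.2.le
        calc (1 / 2 : ℝ) ^ |δ| * a ^ δ ≤ (x / a) ^ δ * a ^ δ := by
              gcongr
              exact (Real.rpow_le_rpow (by norm_num) h1 (abs_nonneg δ)).trans
                (Real.rpow_le_rpow_of_exponent_ge (by positivity) h2 (le_abs_self δ))
          _ = x ^ δ := by
              rw [← Real.mul_rpow (by positivity) ha.le, div_mul_cancel₀ _ ha.ne']

theorem le_Hinflog_indicator_Icc {x : ℝ} (hx : 0 < x) (hx1 : x < 1) :
    x⁻¹ * -Real.log x ≤ Hinflog ((Icc (1 : ℝ) 2).indicator 1) x := by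
  have hsub : Icc (1 : ℝ) 2 ⊆ Ioi x := fun y hy => hx1.trans_le hy.1
  have h1 : ∫ y in Ioi x, Real.log (y / x) * (Icc (1 : ℝ) 2).indicator 1 y =
      ∫ y in Icc (1 : ℝ) 2, Real.log (y / x) := by
    have : (fun y => Real.log (y / x) * (Icc (1 : ℝ) 2).indicator (1 : ℝ → ℝ) y) =
        (Icc (1 : ℝ) 2).indicator fun y => Real.log (y / x) := by
      ext y
      by_cases hy : y ∈ Icc (1 : ℝ) 2 <;> simp only [hy, indicator_of_mem, indicator_of_notMem,
        not_false_eq_true, Pi.one_apply, mul_one, mul_zero]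
    rw [this, setIntegral_indicator measurableSet_Icc, inter_eq_self_of_subset_right hsub]
  rw [Hinflog, h1]
  gcongr
  have h2 : ContinuousOn (fun y => Real.log (y / x)) (Icc (1 : ℝ) 2) :=
    ContinuousOn.log (by fun_prop) fun y hy => (div_pos (by linarith [hy.1]) hx).ne'
  have h3 := setIntegral_ge_of_const_le (μ := volume) (c := -Real.log x)
    (measurableSet_Icc (a := (1 : ℝ)))
    (by simp) (fun y hy => ?_) (h2.integrableOn_compact isCompact_Icc)
  · refine le_trans (le_of_eq ?_) h3
    simp [Measure.real]
    norm_num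
  · rw [Real.log_div (by linarith [hy.1]) hx.ne']
    linarith [Real.log_nonneg hy.1]

theorem not_isRestrictedWeakType_Hinflog {δ p : ℝ} (hp : 1 ≤ p) (hδ : δ ≤ p - 1) :
    ¬ IsRestrictedWeakType Hinflog p δ := by
  rintro ⟨C, hC⟩
  have hp0 : 0 < p := by linarith
  have hE := powMeasure_Icc_one_two_lt_top δ
  set M := (C * powMeasure δ (Icc 1 2)).toReal with hM
  have hM0 : 0 ≤ M := ENNReal.toReal_nonneg
  have key : ∀ L : ℝ, 0 < L → L ^ p * (1 / 2) ^ (|δ| + 1) ≤ M := by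
    intro L hL
    set a := Real.exp (-L) with ha_def
    have ha : 0 < a := Real.exp_pos _
    have ha1 : a < 1 := Real.exp_lt_one_iff.2 (by linarith)
    have h := hC (Icc 1 2) measurableSet_Icc hE (a⁻¹ * L) (by positivity)
    have hsub : Ioo 0 a ⊆ {y | a⁻¹ * L < |Hinflog ((Icc (1 : ℝ) 2).indicator 1) y|} := by
      intro y hy
      have hlog : L < -Real.log y := by
        have := Real.log_lt_log hy.1 hy.2
        rw [ha_def, Real.log_exp] at this
        linarith
      calc a⁻¹ * L < y⁻¹ * -Real.log y :=
            mul_lt_mul'' (inv_strictAnti₀ hy.1 hy.2) hlog (by positivity) hL.le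
        _ ≤ _ := (le_Hinflog_indicator_Icc hy.1 (hy.2.trans ha1)).trans (le_abs_self _)
    have h2 := (mul_le_mul_right ((le_powMeasure_Ioo δ ha).trans (measure_mono hsub)) _).trans h
    rw [← ENNReal.ofReal_mul (by positivity), ENNReal.ofReal_le_iff_le_toReal
      (ENNReal.mul_lt_top ENNReal.coe_lt_top hE).ne] at h2
    refine le_trans ?_ h2
    have h3 : 1 ≤ a⁻¹ ^ p * a ^ (δ + 1) := by
      rw [Real.inv_rpow ha.le, ← Real.rpow_neg ha.le, ← Real.rpow_add ha]
      exact Real.one_le_rpow_of_pos_of_le_one_of_nonpos ha ha1.le (by linarith)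
    rw [Real.mul_rpow (by positivity) hL.le]
    have h4 : 0 ≤ L ^ p * (1 / 2 : ℝ) ^ (|δ| + 1) := by positivity
    nlinarith [mul_le_mul_of_nonneg_left h3 h4]
  have hc : (0 : ℝ) < (1 / 2) ^ (|δ| + 1) := by positivity
  have h := key (((M + 1) / (1 / 2) ^ (|δ| + 1)) ^ p⁻¹) (by positivity)
  rw [← Real.rpow_mul (by positivity), inv_mul_cancel₀ hp0.ne', Real.rpow_one,
    div_mul_cancel₀ _ hc.ne'] at h
  linarith

theorem stmt7 (δ p : ℝ) (hp : 1 ≤ p) :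
    (p - 1 < δ → IsStrongType Hinflog p δ) ∧
    (δ ≤ p - 1 → ¬ IsRestrictedWeakType Hinflog p δ) :=
  ⟨isStrongType_Hinflog hp, not_isRestrictedWeakType_Hinflog hp⟩

end
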